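/- Let N be a finite ground set and f : 2^N → ℝ a nonnegative set function with f(∅) = 0. Then f is XOS (a pointwise maximum of finitely many nonnegative additive set functions) if and only if f is fractionally subadditive, i.e., for every S ⊆ N and every fractional cover {(αᵢ, Tᵢ)}ᵢ of S one has f(S) ≤ ∑ᵢ αᵢ f(Tᵢ). -/

import Mathlib

open Finset

/-- The minimal information family: the empty set, the ground set, and all singletons. -/
def K0 (N : Type*) [Fintype N] : Set (Finset N) :=
  {∅, (Finset.univ : Finset N)} ∪ {S : Finset N | ∃ i : N, S = {i}}

/-- A set function is subadditive if `f (S ∪ T) ≤ f S + f T` for disjoint `S`, `T`. -/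
def SubadditiveSF {N : Type*} [DecidableEq N] (f : Finset N → ℝ) : Prop :=
  ∀ S T : Finset N, Disjoint S T → f (S ∪ T) ≤ f S + f T

/-- A set function is monotone if `S ⊆ T` implies `f S ≤ f T`. -/
def MonotoneSF {N : Type*} (f : Finset N → ℝ) : Prop :=
  ∀ S T : Finset N, S ⊆ T → f S ≤ f T

/-- Elementwise monotonicity: `f S ≤ f (S ∪ {i})`. -/
def MonotoneStep {N : Type*} [DecidableEq N] (f : Finset N → ℝ) : Prop :=
  ∀ (S : Finset N) (i : N), i ∉ S → f S ≤ f (insert i S)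

/-- Upper completion: minimum of `∑ f Sᵢ` over families of pairwise disjoint nonempty
sets `Sᵢ ∈ K` partitioning `S`; it is `0` at `∅`. -/
noncomputable def upperC {N : Type*} [DecidableEq N] (f : Finset N → ℝ)
    (K : Set (Finset N)) (S : Finset N) : ℝ :=
  if S = ∅ then 0 else
    sInf {x : ℝ | ∃ P : Finset (Finset N),
      (∀ T ∈ P, T ∈ K) ∧ (∀ T ∈ P, T ≠ ∅) ∧
      (∀ T₁ ∈ P, ∀ T₂ ∈ P, T₁ ≠ T₂ → Disjoint T₁ T₂) ∧
      P.sup id = S ∧ x = ∑ T ∈ P, f T}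

/-- Lower completion: maximum of `f T - upperC f K (T \ S)` over `T ∈ K` with `S ⊆ T`. -/
noncomputable def lowerC {N : Type*} [DecidableEq N] (f : Finset N → ℝ)
    (K : Set (Finset N)) (S : Finset N) : ℝ :=
  sSup {x : ℝ | ∃ T ∈ K, S ⊆ T ∧ x = f T - upperC f K (T \ S)}

/-- The ℓ¹-divergence of `f` with revealed family `K ⊆ 2^N \ K0`. -/
noncomputable def ldiv {N : Type*} [Fintype N] [DecidableEq N] (f : Finset N → ℝ)
    (K : Set (Finset N)) : ℝ :=
  ∑ T : Finset N, (upperC f (K0 N ∪ K) T - lowerC f (K0 N ∪ K) T)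

/-- SAM upper completion: minimum of `∑ f Sᵢ` over nonempty finite families
`S₁, …, S_k ∈ K` covering `S`. -/
noncomputable def samUpper {N : Type*} [DecidableEq N] (f : Finset N → ℝ)
    (K : Set (Finset N)) (S : Finset N) : ℝ :=
  sInf {x : ℝ | ∃ (k : ℕ) (Ss : Fin (k + 1) → Finset N),
    (∀ i, Ss i ∈ K) ∧ S ⊆ Finset.univ.sup Ss ∧ x = ∑ i, f (Ss i)}

/-- SAM lower completion. -/
noncomputable def samLower {N : Type*} [DecidableEq N] (f : Finset N → ℝ)
    (K : Set (Finset N)) (S : Finset N) : ℝ :=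
  max (sSup {x : ℝ | ∃ Y ∈ K, Y ⊆ S ∧ x = f Y})
      (sSup {x : ℝ | ∃ X ∈ K, S ⊆ X ∧ x = f X - samUpper f K (X \ S)})

/-- The SAM ℓ¹-divergence. -/
noncomputable def samDiv {N : Type*} [Fintype N] [DecidableEq N] (f : Finset N → ℝ)
    (K : Set (Finset N)) : ℝ :=
  ∑ T : Finset N, (samUpper f (K0 N ∪ K) T - samLower f (K0 N ∪ K) T)

/-- `{(α i, T i)}` is a fractional cover of `S`. -/
def IsFracCover {N : Type*} [DecidableEq N] (S : Finset N) (k : ℕ)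
    (α : Fin k → ℝ) (T : Fin k → Finset N) : Prop :=
  (∀ i, 0 < α i) ∧
  ∀ j ∈ S, (1 : ℝ) ≤ ∑ i ∈ Finset.univ.filter (fun i => j ∈ T i), α i

/-- A set function is fractionally subadditive. -/
def FracSubadditive {N : Type*} [DecidableEq N] (f : Finset N → ℝ) : Prop :=
  ∀ (S : Finset N) (k : ℕ) (α : Fin k → ℝ) (T : Fin k → Finset N),
    IsFracCover S k α T → f S ≤ ∑ i, α i * f (T i)

/-- XOS: pointwise maximum of finitely many nonnegative additive set functions. -/
def IsXOS {N : Type*} (f : Finset N → ℝ) : Prop :=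
  ∃ (s : ℕ) (a : Fin (s + 1) → N → ℝ),
    (∀ i j, 0 ≤ a i j) ∧
    ∀ S : Finset N, f S = Finset.univ.sup' Finset.univ_nonempty (fun i => ∑ j ∈ S, a i j)

/-- XOS upper completion: infimum of `∑ αᵢ f Tᵢ` over fractional covers of `S`
using sets from `K`. -/
noncomputable def xosUpper {N : Type*} [DecidableEq N] (f : Finset N → ℝ)
    (K : Set (Finset N)) (S : Finset N) : ℝ :=
  sInf {x : ℝ | ∃ (k : ℕ) (α : Fin k → ℝ) (T : Fin k → Finset N),
    IsFracCover S k α T ∧ (∀ i, T i ∈ K) ∧ x = ∑ i, α i * f (T i)}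

/-- The costs `∑ α T * f T` of the nonnegative weightings `α` of subsets covering the vector `x`. -/
def coverCosts {N : Type*} [Fintype N] [DecidableEq N] (f : Finset N → ℝ) (x : N → ℝ) : Set ℝ :=
  {c : ℝ | ∃ α : Finset N → ℝ, (∀ T, 0 ≤ α T) ∧
    (∀ j, x j ≤ ∑ T, if j ∈ T then α T else 0) ∧ c = ∑ T, α T * f T}

section coverCosts

variable {N : Type*} [Fintype N] [DecidableEq N] {f : Finset N → ℝ}

theorem nonneg_of_mem_coverCosts (hnn : ∀ S, 0 ≤ f S) {x : N → ℝ} {c : ℝ}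
    (hc : c ∈ coverCosts f x) : 0 ≤ c := by
  obtain ⟨α, hα, -, rfl⟩ := hc
  exact Finset.sum_nonneg fun T _ => mul_nonneg (hα T) (hnn T)

theorem bddBelow_coverCosts (hnn : ∀ S, 0 ≤ f S) (x : N → ℝ) : BddBelow (coverCosts f x) :=
  ⟨0, fun _ hc => nonneg_of_mem_coverCosts hnn hc⟩

theorem coverCosts_nonempty (f : Finset N → ℝ) (x : N → ℝ) : (coverCosts f x).Nonempty := by
  refine ⟨_, fun _ => ∑ j, |x j|, fun _ => Finset.sum_nonneg fun j _ => abs_nonneg _, fun j => ?_,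
    rfl⟩
  calc x j ≤ |x j| := le_abs_self _
    _ ≤ ∑ j, |x j| := Finset.single_le_sum (fun j _ => abs_nonneg (x j)) (Finset.mem_univ j)
    _ = if j ∈ ({j} : Finset N) then ∑ j, |x j| else 0 := by simp
    _ ≤ _ := Finset.single_le_sum
      (f := fun T : Finset N => if j ∈ T then ∑ j, |x j| else 0)
      (fun T _ => by positivity) (Finset.mem_univ {j})

theorem smul_mem_coverCosts {x : N → ℝ} {c r : ℝ} (hr : 0 ≤ r) (hc : c ∈ coverCosts f x) :
    r * c ∈ coverCosts f (r • x) := by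
  obtain ⟨α, hα, hx, rfl⟩ := hc
  refine ⟨fun T => r * α T, fun T => mul_nonneg hr (hα T), fun j => ?_, ?_⟩
  · have := mul_le_mul_of_nonneg_left (hx j) hr
    simpa [Finset.mul_sum] using this
  · simp [Finset.mul_sum, mul_assoc]

theorem add_mem_coverCosts {x y : N → ℝ} {c d : ℝ} (hc : c ∈ coverCosts f x)
    (hd : d ∈ coverCosts f y) : c + d ∈ coverCosts f (x + y) := by
  obtain ⟨α, hα, hx, rfl⟩ := hc
  obtain ⟨β, hβ, hy, rfl⟩ := hd
  refine ⟨fun T => α T + β T, fun T => add_nonneg (hα T) (hβ T), fun j => ?_, ?_⟩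
  · refine (add_le_add (hx j) (hy j)).trans_eq ?_
    rw [← Finset.sum_add_distrib]
    exact Finset.sum_congr rfl fun T _ => by split_ifs <;> simp
  · simp [Finset.sum_add_distrib, add_mul]

theorem zero_mem_coverCosts {x : N → ℝ} (hx : ∀ j, x j ≤ 0) : 0 ∈ coverCosts f x :=
  ⟨0, by simp, by simpa using hx, by simp⟩

theorem mem_coverCosts_indicator (f : Finset N → ℝ) (S : Finset N) :
    f S ∈ coverCosts f (fun j => if j ∈ S then 1 else 0) := by
  refine ⟨Pi.single S 1, fun T => ?_, fun j => ?_, ?_⟩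
  · by_cases h : T = S
    · subst h; simp
    · simp [h]
  · rw [Finset.sum_eq_single S (fun T _ h => by simp [h]) (by simp)]
    simp
  · rw [Finset.sum_eq_single S (fun T _ h => by simp [h]) (by simp)]
    simp

theorem FracSubadditive.le_of_mem_coverCosts (hf : FracSubadditive f) {S : Finset N}
    {c : ℝ} (hc : c ∈ coverCosts f (fun j => if j ∈ S then 1 else 0)) : f S ≤ c := by
  obtain ⟨α, hα, hS, rfl⟩ := hc
  let P : Finset (Finset N) := Finset.univ.filter fun T => 0 < α T
  have hsum : ∀ g : Finset N → ℝ, (∀ T, α T = 0 → g T = 0) →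
      ∑ i, g (P.equivFin.symm i) = ∑ T, g T := fun g hg => by
    rw [Equiv.sum_comp P.equivFin.symm (fun T : P => g T), Finset.sum_coe_sort P g]
    refine Finset.sum_subset (Finset.subset_univ _) fun T _ hT => hg T ?_
    exact le_antisymm (by simpa [P] using hT) (hα T)
  have := hf S P.card (fun i => α (P.equivFin.symm i)) (fun i => P.equivFin.symm i)
    ⟨fun i => (Finset.mem_filter.1 (P.equivFin.symm i).2).2, fun j hj => ?_⟩
  · rwa [hsum (fun T => α T * f T) fun T hT => by simp [hT]] at this
  · rw [Finset.sum_filter, hsum (fun T => if j ∈ T then α T else 0) fun T hT => by simp [hT]]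
    simpa [hj] using hS j

theorem sInf_coverCosts_smul (hnn : ∀ S, 0 ≤ f S) (r : ℝ) (hr : 0 < r) (x : N → ℝ) :
    sInf (coverCosts f (r • x)) = r * sInf (coverCosts f x) := by
  have key : ∀ (r : ℝ), 0 < r → ∀ x : N → ℝ,
      sInf (coverCosts f (r • x)) ≤ r * sInf (coverCosts f x) := fun r hr x => by
    rw [← div_le_iff₀' hr]
    refine le_csInf (coverCosts_nonempty f x) fun c hc => ?_
    rw [div_le_iff₀' hr]
    exact csInf_le (bddBelow_coverCosts hnn _) (smul_mem_coverCosts hr.le hc)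
  refine (key r hr x).antisymm ?_
  have := key r⁻¹ (inv_pos.2 hr) (r • x)
  rwa [inv_smul_smul₀ hr.ne', ← div_eq_inv_mul, le_div_iff₀' hr] at this

theorem sInf_coverCosts_add_le (hnn : ∀ S, 0 ≤ f S) (x y : N → ℝ) :
    sInf (coverCosts f (x + y)) ≤ sInf (coverCosts f x) + sInf (coverCosts f y) := by
  rw [← sub_le_iff_le_add]
  refine le_csInf (coverCosts_nonempty f x) fun c hc => ?_
  rw [sub_le_comm]
  refine le_csInf (coverCosts_nonempty f y) fun d hd => ?_
  rw [sub_le_iff_le_add']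
  exact csInf_le (bddBelow_coverCosts hnn _) (add_mem_coverCosts hc hd)

/-- A fractionally subadditive function is supported at each set by a nonnegative additive
function lying below it. -/
theorem FracSubadditive.exists_additive_le (hf : FracSubadditive f) (hf0 : f ∅ = 0)
    (hnn : ∀ S, 0 ≤ f S) (S : Finset N) :
    ∃ a : N → ℝ, (∀ j, 0 ≤ a j) ∧ (∀ T, ∑ j ∈ T, a j ≤ f T) ∧ ∑ j ∈ S, a j = f S := by
  rcases S.eq_empty_or_nonempty with rfl | ⟨j₀, hj₀⟩
  · exact ⟨0, by simp, by simpa using hnn, by simp [hf0]⟩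
  let e : Finset N → N → ℝ := fun T j => if j ∈ T then 1 else 0
  have he : e S ≠ 0 := fun h => by simpa [e, hj₀] using congrFun h j₀
  have hp : ∀ x, 0 ≤ sInf (coverCosts f x) := fun x =>
    Real.sInf_nonneg fun c hc => nonneg_of_mem_coverCosts hnn hc
  have hpS : f S ≤ sInf (coverCosts f (e S)) :=
    le_csInf (coverCosts_nonempty f _) fun c hc => hf.le_of_mem_coverCosts hc
  obtain ⟨g, hg, hgp⟩ := exists_extension_of_le_sublinear
    (LinearPMap.mkSpanSingleton (K := ℝ) (e S) (f S) he) (fun x => sInf (coverCosts f x))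
    (sInf_coverCosts_smul hnn) (sInf_coverCosts_add_le hnn) (by
      rintro ⟨x, hx⟩
      obtain ⟨t, rfl⟩ := Submodule.mem_span_singleton.1 hx
      rw [LinearPMap.mkSpanSingleton'_apply, RingHom.id_apply, smul_eq_mul]
      rcases le_or_gt t 0 with ht | ht
      · exact (mul_nonpos_of_nonpos_of_nonneg ht (hnn S)).trans (hp _)
      · dsimp only
        rw [sInf_coverCosts_smul hnn t ht]
        exact mul_le_mul_of_nonneg_left hpS ht.le)
  have hsum : ∀ T, ∑ j ∈ T, g (Pi.single j 1) = g (e T) := fun T => by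
    rw [← map_sum]
    congr 1
    ext j
    simp [e, Finset.sum_apply, Pi.single_apply]
  refine ⟨fun j => g (Pi.single j 1), fun j => ?_, fun T => ?_, ?_⟩
  · have h : g (-Pi.single j 1) ≤ 0 := (hgp _).trans <|
      csInf_le (bddBelow_coverCosts hnn _) <| zero_mem_coverCosts fun i => by
        by_cases h : i = j
        · subst h; simp
        · simp [h]
    simpa using h
  · rw [hsum]
    exact (hgp _).trans (csInf_le (bddBelow_coverCosts hnn _) (mem_coverCosts_indicator f T))
  · rw [hsum]
    refine (hg ⟨e S, Submodule.mem_span_singleton_self _⟩).trans ?_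
    exact LinearPMap.mkSpanSingleton_apply ℝ ℝ he (f S)

end coverCosts

theorem IsXOS.fracSubadditive {N : Type*} [DecidableEq N] {f : Finset N → ℝ} (hf : IsXOS f) :
    FracSubadditive f := by
  obtain ⟨s, a, ha, hfa⟩ := hf
  intro S k α T ⟨hα, hcov⟩
  rw [hfa S]
  refine Finset.sup'_le _ _ fun i _ => ?_
  calc ∑ j ∈ S, a i j
      ≤ ∑ j ∈ S, ∑ l, (if j ∈ T l then α l * a i j else 0) := by
        refine Finset.sum_le_sum fun j hj => ?_
        have := mul_le_mul_of_nonneg_right (hcov j hj) (ha i j)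
        rwa [one_mul, Finset.sum_mul, Finset.sum_filter] at this
    _ = ∑ l, α l * ∑ j ∈ S with j ∈ T l, a i j := by
        rw [Finset.sum_comm]
        simp only [Finset.mul_sum, Finset.sum_filter, mul_ite, mul_zero]
    _ ≤ ∑ l, α l * f (T l) := by
        refine Finset.sum_le_sum fun l _ => mul_le_mul_of_nonneg_left ?_ (hα l).le
        rw [hfa (T l)]
        refine le_trans ?_ (Finset.le_sup' (fun i => ∑ j ∈ T l, a i j) (Finset.mem_univ i))
        exact Finset.sum_le_sum_of_subset_of_nonneg
          (fun j hj => (Finset.mem_filter.1 hj).2) fun j _ _ => ha i j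

/-- a nonnegative set function is XOS iff it is fractionally subadditive. -/
theorem xos_iff_fracSubadditive {N : Type*} [Fintype N] [DecidableEq N]
    (f : Finset N → ℝ) (hf0 : f ∅ = 0) (hnn : ∀ S : Finset N, 0 ≤ f S) :
    IsXOS f ↔ FracSubadditive f := by
  refine ⟨IsXOS.fracSubadditive, fun hf => ?_⟩
  choose a ha hle heq using hf.exists_additive_le hf0 hnn
  obtain ⟨s, hs⟩ := Nat.exists_eq_succ_of_ne_zero (Fintype.card_ne_zero (α := Finset N))
  let φ : Finset N ≃ Fin (s + 1) := Fintype.equivFinOfCardEq hs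
  refine ⟨s, fun i => a (φ.symm i), fun i => ha _, fun S => le_antisymm ?_ ?_⟩
  · refine le_trans ?_ (Finset.le_sup' (fun i => ∑ j ∈ S, a (φ.symm i) j) (Finset.mem_univ (φ S)))
    simp [heq]
  · exact Finset.sup'_le _ _ fun i _ => hle _ S
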